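/- arXiv:2110.03654 — 5 statements merged into one kernel-verified Lean document; each statement's English description precedes it below -/
import Mathlib

section
/- Let Γ be a looped graph, A a bidirected valence system over Γ, and s,t states of A such that there is a run s →w₀ t. Then { [w] ∈ MΓ : there is a run s →w t } equals the left coset [w₀]·S, where S = { [w] : there is a run t →w t } (a subgroup of MΓ). -/
open scoped Classical

/-- An undirected graph (finite in applications), with self-loops allowed:
`adj v v` means that `v` is looped. -/
structure GGraph (V : Type) where
  adj : V → V → Prop
  symm : ∀ u v, adj u v → adj v u

namespace ValencePaper

variable {V Q : Type}

/-- The alphabet `X_Γ = V ∪ V̄`: `Sum.inl v` is the letter `v`,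
`Sum.inr v` is the letter `v̄`. -/
abbrev XLetter (V : Type) := V ⊕ V

/-- Words over `X_Γ`. -/
abbrev GWord (V : Type) := List (XLetter V)

/-- The bar operation on letters, swapping `v` and `v̄`. -/
def barL : XLetter V → XLetter V := Sum.elim Sum.inr Sum.inl

/-- The inverse word `w̄`. -/
def barW (w : GWord V) : GWord V := (w.map barL).reverse

/-- The vertex a letter refers to. -/
def vtx : XLetter V → V := Sum.elim id id

/-- One-step rewriting `s u t →_R s v t` for a set of rules `R`. -/
inductive RStep {α : Type} (R : Set (List α × List α)) : List α → List α → Prop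
  | intro (s t : List α) {a b : List α} (h : (a, b) ∈ R) :
      RStep R (s ++ a ++ t) (s ++ b ++ t)

/-- The rule set `R_Γ`: cancellation `v v̄ → ε` and commutation `xy → yx`
for letters over adjacent vertices. -/
def GRules (Γ : GGraph V) : Set (GWord V × GWord V) :=
  {p | ∃ v : V, p = ([Sum.inl v, Sum.inr v], [])} ∪
  {p | ∃ (a b : V) (x y : XLetter V),
      (x = Sum.inl a ∨ x = Sum.inr a) ∧ (y = Sum.inl b ∨ y = Sum.inr b) ∧
      Γ.adj a b ∧ p = ([x, y], [y, x])}

/-- The congruence `≡_Γ`: the smallest equivalence relation containing `→_Γ`. -/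
def GEquiv (Γ : GGraph V) : GWord V → GWord V → Prop :=
  Relation.EqvGen (RStep (GRules Γ))

/-- The graph monoid `MΓ = X_Γ*/≡_Γ`. -/
def GMonoid (Γ : GGraph V) := Quot (RStep (GRules Γ))

/-- The class `[w]` of a word `w` in `MΓ`. -/
def gmk (Γ : GGraph V) (w : GWord V) : GMonoid Γ := Quot.mk _ w

/-- Runs of a valence system with transition set `E`: `Run E p w q` means
there is a sequence of transitions from `p` to `q` whose labels concatenate to `w`. -/
inductive Run (E : Set (Q × GWord V × Q)) : Q → GWord V → Q → Prop
  | nil (q : Q) : Run E q [] q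
  | cons {p : Q} {w : GWord V} {q : Q} {u : GWord V} {r : Q} :
      (p, w, q) ∈ E → Run E q u r → Run E p (w ++ u) r

/-- A transition set is bidirected if for any transition `p →w q`
it also contains the transition `q →w̄ p`. -/
def Bidirected (E : Set (Q × GWord V × Q)) : Prop :=
  ∀ p w q, (p, w, q) ∈ E → (q, barW w, p) ∈ E

/-- Every vertex of `Γ` carries a self-loop. -/
def Looped (Γ : GGraph V) : Prop := ∀ v, Γ.adj v v

/-- `Γ°`: the graph `Γ` with self-loops added on all vertices. -/
def loopify (Γ : GGraph V) : GGraph V :=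
  ⟨fun a b => Γ.adj a b ∨ a = b, by
    intro u v h
    rcases h with h | h
    · exact Or.inl (Γ.symm u v h)
    · exact Or.inr h.symm⟩

end ValencePaper

open ValencePaper

namespace ValencePaper

variable {V Q : Type}

theorem Run.append {E : Set (Q × GWord V × Q)} {p q r : Q} {u v : GWord V}
    (hu : Run E p u q) (hv : Run E q v r) : Run E p (u ++ v) r := by
  induction hu with
  | nil => exact hv
  | cons hE _ ih => rw [List.append_assoc]; exact .cons hE (ih hv)

theorem Run.single {E : Set (Q × GWord V × Q)} {p q : Q} {w : GWord V}
    (h : (p, w, q) ∈ E) : Run E p w q := by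
  simpa using Run.cons h (Run.nil q)

theorem barW_append (u v : GWord V) : barW (u ++ v) = barW v ++ barW u := by
  simp [barW]

theorem Run.reverse {E : Set (Q × GWord V × Q)} (hbi : Bidirected E) {p q : Q} {w : GWord V}
    (h : Run E p w q) : Run E q (barW w) p := by
  induction h with
  | nil q => exact .nil q
  | cons hE _ ih => rw [barW_append]; exact ih.append (.single (hbi _ _ _ hE))

theorem RStep.append_context {α : Type} {R : Set (List α × List α)} {a b : List α}
    (h : RStep R a b) (s t : List α) : RStep R (s ++ a ++ t) (s ++ b ++ t) := by
  obtain ⟨s', t', h⟩ := h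
  simpa using RStep.intro (s ++ s') (t' ++ t) h

theorem gmk_append_context {Γ : GGraph V} {a b : GWord V} (h : gmk Γ a = gmk Γ b)
    (s t : GWord V) : gmk Γ (s ++ a ++ t) = gmk Γ (s ++ b ++ t) :=
  congrArg (Quot.map (fun w => s ++ w ++ t) fun _ _ hab => hab.append_context s t) h

theorem gmk_eq_of_mem {Γ : GGraph V} {a b : GWord V} (h : (a, b) ∈ GRules Γ) :
    gmk Γ a = gmk Γ b :=
  Quot.sound (by simpa using RStep.intro [] [] h)

theorem gmk_letter_barL {Γ : GGraph V} (hloop : Looped Γ) (x : XLetter V) :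
    gmk Γ [x, barL x] = gmk Γ [] := by
  have cancel (v : V) : gmk Γ [Sum.inl v, Sum.inr v] = gmk Γ [] :=
    gmk_eq_of_mem (.inl ⟨v, rfl⟩)
  cases x with
  | inl v => exact cancel v
  | inr v =>
    exact (gmk_eq_of_mem (.inr ⟨v, v, _, _, .inr rfl, .inl rfl, hloop v, rfl⟩)).trans (cancel v)

/-- Over a looped graph, `w̄` is a right inverse of `w`. -/
theorem gmk_append_barW {Γ : GGraph V} (hloop : Looped Γ) (w : GWord V) :
    gmk Γ (w ++ barW w) = gmk Γ [] := by
  induction w with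
  | nil => rfl
  | cons x w ih =>
    have h := gmk_append_context ih [x] [barL x]
    simpa [barW] using h.trans (gmk_letter_barL hloop x)

end ValencePaper

/-- For a looped graph `Γ`, a bidirected valence system over `Γ`
with states `s, t` and a run `s →w₀ t`, the set `{ [w] : there is a run s →w t }`
is the left coset `[w₀]·S` of the subgroup `S = { [w] : there is a run t →w t }`,
i.e. it equals `{ [w₀ ++ h] : there is a run t →h t }`. -/
theorem reach_set_is_coset {V Q : Type} [Finite Q] (Γ : GGraph V)
    (hloop : Looped Γ) (E : Set (Q × GWord V × Q)) (hEfin : E.Finite)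
    (hbi : Bidirected E) (s t : Q) (w₀ : GWord V) (hw₀ : Run E s w₀ t) :
    {m : GMonoid Γ | ∃ w, Run E s w t ∧ m = gmk Γ w} =
      {m : GMonoid Γ | ∃ h, Run E t h t ∧ m = gmk Γ (w₀ ++ h)} := by
  ext m
  constructor
  · rintro ⟨w, hw, rfl⟩
    refine ⟨barW w₀ ++ w, (hw₀.reverse hbi).append hw, ?_⟩
    simpa using (gmk_append_context (gmk_append_barW hloop w₀) [] w).symm
  · rintro ⟨h, hh, rfl⟩
    exact ⟨w₀ ++ h, hw₀.append hh, rfl⟩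
end

section
/- Let Γ be a graph with two non-adjacent vertices u and v where u is unlooped. For k ∈ ℕ set w_i = u v^i for i ∈ [1,k] and W = {w₁, …, w_k}. Then for all x ∈ (W ∪ W̄)*, one has x ≡_Γ ε if and only if x can be transformed to ε by the smallest congruence containing the rules w_i w̄_i → ε (i ∈ [1,k]); i.e., x ≡_Γ ε iff x ↔*_R ε where R = {(w_i w̄_i, ε) : i ∈ [1,k]}. -/
open scoped Classical

namespace ValencePaper

variable {V : Type}

/-- The word `w_i = u v^i`. -/
def pword (u v : V) (i : ℕ) : GWord V :=
  Sum.inl u :: List.replicate i (Sum.inl v)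

/-- The rule set `R = {(w_i w̄_i, ε) : i ∈ [1,k]}`. -/
def cancelRules (u v : V) (k : ℕ) : Set (GWord V × GWord V) :=
  {p | ∃ i : ℕ, 1 ≤ i ∧ i ≤ k ∧ p = (pword u v i ++ barW (pword u v i), ([] : GWord V))}

/-- Membership in `(W ∪ W̄)*` for `W = {w₁, …, w_k}`: `x` is a concatenation of
blocks, each of which is some `w_i` or `w̄_i` with `i ∈ [1,k]`. -/
def InStar (u v : V) (k : ℕ) (x : GWord V) : Prop :=
  ∃ parts : List (GWord V),
    (∀ b ∈ parts, ∃ i : ℕ, 1 ≤ i ∧ i ≤ k ∧ (b = pword u v i ∨ b = barW (pword u v i))) ∧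
    x = parts.flatten

end ValencePaper

open ValencePaper

namespace ValencePaper

section Congruence

variable {α : Type} {R : Set (List α × List α)}

theorem RStep.context {a b : List α} (s t : List α) (h : RStep R a b) :
    RStep R (s ++ a ++ t) (s ++ b ++ t) := by
  obtain ⟨p, q, h⟩ := h
  simpa using RStep.intro (s ++ p) (q ++ t) h

theorem eqvGen_rStep_context {a b : List α} (s t : List α)
    (h : Relation.EqvGen (RStep R) a b) :
    Relation.EqvGen (RStep R) (s ++ a ++ t) (s ++ b ++ t) := by
  induction h with
  | rel _ _ h => exact .rel _ _ (h.context s t)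
  | refl => exact .refl _
  | symm _ _ _ ih => exact .symm _ _ ih
  | trans _ _ _ _ _ ih₁ ih₂ => exact .trans _ _ _ ih₁ ih₂

end Congruence

variable {V : Type}

theorem gEquiv_append_barW (Γ : GGraph V) (w : List V) :
    GEquiv Γ (w.map Sum.inl ++ barW (w.map Sum.inl)) [] := by
  induction w using List.reverseRecOn with
  | nil => exact .refl _
  | append_singleton w a ih =>
    refine .trans _ _ _ (.rel _ _ ?_) ih
    have h : (([Sum.inl a, Sum.inr a], []) : GWord V × GWord V) ∈ GRules Γ := Or.inl ⟨a, rfl⟩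
    simpa [barW, barL] using
      RStep.intro (w.map Sum.inl) (barW (w.map Sum.inl)) h

theorem gEquiv_of_eqvGen_cancelRules (Γ : GGraph V) {u v : V} {k : ℕ} {x y : GWord V}
    (h : Relation.EqvGen (RStep (cancelRules u v k)) x y) : GEquiv Γ x y := by
  induction h with
  | rel _ _ h =>
    obtain ⟨s, t, i, -, -, h⟩ := h
    obtain ⟨rfl, rfl⟩ := Prod.mk.inj h
    refine eqvGen_rStep_context s t ?_
    have h := gEquiv_append_barW Γ (u :: List.replicate i v)
    simp only [List.map_cons, List.map_replicate] at h
    exact h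
  | refl => exact .refl _
  | symm _ _ _ ih => exact .symm _ _ ih
  | trans _ _ _ _ _ ih₁ ih₂ => exact .trans _ _ _ ih₁ ih₂

/-- The partial action of a letter on nonempty stacks of integers, given by the top entry and the
remaining entries: `u` pushes `0`, `ū` pops a top entry `0`, while `v` and `v̄` increment and
decrement the top entry. Letters over other vertices act trivially. -/
noncomputable def stackAct (u v : V) : ℤ × List ℤ → XLetter V → Option (ℤ × List ℤ)
  | (c, r), Sum.inl a =>
    if a = u then some (0, c :: r) else if a = v then some (c + 1, r) else some (c, r)
  | (c, []), Sum.inr a =>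
    if a = u then none else if a = v then some (c - 1, []) else some (c, [])
  | (c, d :: r), Sum.inr a =>
    if a = u then (if c = 0 then some (d, r) else none)
    else if a = v then some (c - 1, d :: r) else some (c, d :: r)

/-- The partial action of a word on stacks, reading the word from left to right. -/
noncomputable def stackRun (u v : V) (w : GWord V) (s : ℤ × List ℤ) : Option (ℤ × List ℤ) :=
  w.foldlM (stackAct u v) s

theorem stackRun_append (u v : V) (w x : GWord V) (s : ℤ × List ℤ) :
    stackRun u v (w ++ x) s = (stackRun u v w s).bind (stackRun u v x) := by
  simp only [stackRun, List.foldlM_append]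
  rfl

theorem stackRun_cons (u v : V) (a : XLetter V) (x : GWord V) (s : ℤ × List ℤ) :
    stackRun u v (a :: x) s = (stackAct u v s a).bind (stackRun u v x) := rfl

theorem stackRun_nil (u v : V) (s : ℤ × List ℤ) : stackRun u v [] s = some s := rfl

theorem stackRun_eq_of_mem_gRules {Γ : GGraph V} {u v : V} (huv : u ≠ v)
    (hnadj : ¬ Γ.adj u v) (hunl : ¬ Γ.adj u u) {a b : GWord V} (h : (a, b) ∈ GRules Γ) :
    stackRun u v a = stackRun u v b := by
  have hnadj' : ¬ Γ.adj v u := fun h => hnadj (Γ.symm _ _ h)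
  funext ⟨c, r⟩
  rcases h with ⟨a, h⟩ | ⟨a, b, x, y, hx, hy, hab, h⟩
  · obtain ⟨rfl, rfl⟩ := Prod.mk.inj h
    by_cases hu : a = u
    · simp [stackRun_cons, stackRun_nil, stackAct, hu]
    · by_cases hv : a = v <;> cases r <;>
        simp [stackRun_cons, stackRun_nil, stackAct, hv, hu, huv.symm]
  · obtain ⟨rfl, rfl⟩ := Prod.mk.inj h
    have key : (a ≠ u ∧ a ≠ v) ∨ (b ≠ u ∧ b ≠ v) ∨ (a = v ∧ b = v) := by
      by_cases h₁ : a = u <;> by_cases h₂ : a = v <;> by_cases h₃ : b = u <;>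
        by_cases h₄ : b = v <;> simp_all
    have triv : ∀ d : V, d ≠ u → d ≠ v → ∀ z : XLetter V, z = Sum.inl d ∨ z = Sum.inr d →
        ∀ s, stackAct u v s z = some s := by
      rintro d h₁ h₂ z (rfl | rfl) ⟨c, _ | ⟨e, r⟩⟩ <;> simp [stackAct, h₁, h₂]
    rcases key with ⟨h₁, h₂⟩ | ⟨h₁, h₂⟩ | ⟨rfl, rfl⟩
    · have := triv a h₁ h₂ x hx
      simp [stackRun, this]
    · have := triv b h₁ h₂ y hy
      simp [stackRun, this]
    · rcases hx with rfl | rfl <;> rcases hy with rfl | rfl <;> cases r <;>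
        simp [stackRun_cons, stackRun_nil, stackAct, huv.symm]

theorem stackRun_eq_of_gEquiv {Γ : GGraph V} {u v : V} (huv : u ≠ v)
    (hnadj : ¬ Γ.adj u v) (hunl : ¬ Γ.adj u u) {x y : GWord V} (h : GEquiv Γ x y) :
    stackRun u v x = stackRun u v y := by
  induction h with
  | rel _ _ h =>
    obtain ⟨s, t, h⟩ := h
    funext σ
    simp only [stackRun_append, stackRun_eq_of_mem_gRules huv hnadj hunl h]
  | refl => rfl
  | symm _ _ _ ih => exact ih.symm
  | trans _ _ _ _ _ ih₁ ih₂ => exact ih₁.trans ih₂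

theorem stackRun_replicate_inl {u v : V} (huv : u ≠ v) (i : ℕ) (c : ℤ) (r : List ℤ) :
    stackRun u v (List.replicate i (Sum.inl v)) (c, r) = some (c + i, r) := by
  induction i generalizing c with
  | zero => simp [stackRun_nil]
  | succ i ih =>
    simp [List.replicate_succ, stackRun_cons, stackAct, huv.symm, ih]
    ring

theorem stackRun_replicate_inr {u v : V} (huv : u ≠ v) (i : ℕ) (c : ℤ) (r : List ℤ) :
    stackRun u v (List.replicate i (Sum.inr v)) (c, r) = some (c - i, r) := by
  induction i generalizing c with
  | zero => simp [stackRun_nil]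
  | succ i ih =>
    cases r <;> simp [List.replicate_succ, stackRun_cons, stackAct, huv.symm, ih] <;> ring

theorem stackRun_pword {u v : V} (huv : u ≠ v) (i : ℕ) (c : ℤ) (r : List ℤ) :
    stackRun u v (pword u v i) (c, r) = some ((i : ℤ), c :: r) := by
  simp [pword, stackRun_cons, stackAct, stackRun_replicate_inl huv]

theorem stackRun_barW_pword {u v : V} (huv : u ≠ v) (i : ℕ) (c : ℤ) (r : List ℤ) :
    stackRun u v (barW (pword u v i)) (c, r) = stackAct u v (c - i, r) (Sum.inr u) := by
  have : barW (pword u v i) = List.replicate i (Sum.inr v) ++ [Sum.inr u] := by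
    simp [barW, pword, barL]
  rw [this, stackRun_append, stackRun_replicate_inr huv]
  rw [Option.bind_some, stackRun_cons]
  exact Option.bind_fun_some _

/-- The stack reached from `(0, [])` by pushing the entries of a list, last entry first. -/
def pushedStack : List ℕ → ℤ × List ℤ
  | [] => (0, [])
  | i :: S => (i, (pushedStack S).1 :: (pushedStack S).2)

/-- The word over the `w_i` that pushes the entries of a list, last entry first. -/
def pushWord (u v : V) : List ℕ → GWord V
  | [] => []
  | i :: S => pushWord u v S ++ pword u v i

theorem eqvGen_cancelRules_of_stackRun {u v : V} (huv : u ≠ v) {k : ℕ} (parts : List (GWord V))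
    (hparts : ∀ b ∈ parts, ∃ i : ℕ, 1 ≤ i ∧ i ≤ k ∧ (b = pword u v i ∨ b = barW (pword u v i)))
    (S : List ℕ)
    (h : stackRun u v parts.flatten (pushedStack S) = some (0, [])) :
    Relation.EqvGen (RStep (cancelRules u v k)) (pushWord u v S ++ parts.flatten) [] := by
  induction parts generalizing S with
  | nil =>
    cases S with
    | nil => exact .refl _
    | cons i S => simp [stackRun_nil, pushedStack] at h
  | cons b parts ih =>
    specialize ih fun b hb => hparts b (List.mem_cons_of_mem _ hb)
    obtain ⟨i, hi, hik, rfl | rfl⟩ := hparts b List.mem_cons_self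
    · rw [List.flatten_cons, stackRun_append, stackRun_pword huv] at h
      simpa [pushWord] using ih (i :: S) h
    · rw [List.flatten_cons, stackRun_append, stackRun_barW_pword huv] at h
      cases S with
      | nil => simp [pushedStack, stackAct] at h
      | cons j S =>
        by_cases hij : j = i
        · subst hij
          refine .trans _ _ _ ?_ (ih S (by simpa [pushedStack, stackAct] using h))
          have hmem : (pword u v j ++ barW (pword u v j), []) ∈ cancelRules u v k :=
            ⟨j, hi, hik, rfl⟩
          simpa [pushWord] using
            Relation.EqvGen.rel _ _ (RStep.intro (pushWord u v S) parts.flatten hmem)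
        · have : (j : ℤ) - i ≠ 0 := by omega
          simp [pushedStack, stackAct, this] at h

end ValencePaper


/-- Let `Γ` have two non-adjacent vertices `u, v` with `u` unlooped,
`k ∈ ℕ`, `w_i = u v^i` and `W = {w₁, …, w_k}`. Then for all `x ∈ (W ∪ W̄)*`:
`x ≡_Γ ε` iff `x ↔*_R ε` where `R = {(w_i w̄_i, ε) : i ∈ [1,k]}`. -/
theorem simulate_pushdown {V : Type} (Γ : GGraph V) (u v : V) (huv : u ≠ v)
    (hnadj : ¬ Γ.adj u v) (hunl : ¬ Γ.adj u u) (k : ℕ) :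
    ∀ x : GWord V, InStar u v k x →
      (GEquiv Γ x [] ↔ Relation.EqvGen (RStep (cancelRules u v k)) x []) := by
  rintro x ⟨parts, hparts, rfl⟩
  refine ⟨fun h => ?_, gEquiv_of_eqvGen_cancelRules Γ⟩
  have hrun := congrFun (stackRun_eq_of_gEquiv huv hnadj hunl h) (0, [])
  exact eqvGen_cancelRules_of_stackRun huv parts hparts [] hrun
end

section
/- Let Γ be a graph on the four vertices {u₁, v₁, u₂, v₂} (loops arbitrary) whose loop-free version Γ⁻ is the 4-cycle with edges {u₁,u₂}, {u₁,v₂}, {v₁,u₂}, {v₁,v₂} (so u₁,v₁ are non-adjacent and u₂,v₂ are non-adjacent). Then there exist a finite set W ⊆ X_Γ* and a monoid morphism φ : (W ∪ W̄)* → X_Γ* with φ(w) ∈ X_Γ (a single letter) for every w ∈ W and φ(w̄) = φ(w)‾ for every w ∈ W, such that for all y ∈ X_Γ*: y ≡_{Γ°} ε if and only if there exists x ∈ (W ∪ W̄)* with x ≡_Γ ε and φ(x) = y. -/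
open scoped Classical

namespace ValencePaper

variable {V : Type}

/-- The word denoted by a signed block `(w, true) ↦ w`, `(w, false) ↦ w̄`.
A word `x ∈ (W ∪ W̄)*` is presented by a list of signed blocks with first
components in `W`. -/
def blockWord (p : GWord V × Bool) : GWord V := if p.2 then p.1 else barW p.1

/-- The image of a signed block under the morphism `φ` determined by a
letter-valued function `g` on `W` (so `φ(w) = g w ∈ X_Γ` for `w ∈ W`, and
`φ(w̄) = φ(w)‾`). -/
def blockImg (g : GWord V → XLetter V) (p : GWord V × Bool) : GWord V :=
  if p.2 then [g p.1] else [barL (g p.1)]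

/-- `φ` (determined by `g` on the blocks `W ∪ W̄`) witnesses the simulation:
for all `y ∈ X_Γ*`, `y ≡_{Γ°} ε` iff there is `x ∈ (W ∪ W̄)*` (given by a list
of signed blocks over `W`) with `x ≡_Γ ε` and `φ(x) = y`. -/
def SimulatesLoopify (Γ : GGraph V) (W : Set (GWord V)) (g : GWord V → XLetter V) : Prop :=
  ∀ y : GWord V, GEquiv (loopify Γ) y [] ↔
    ∃ parts : List (GWord V × Bool), (∀ p ∈ parts, p.1 ∈ W) ∧
      GEquiv Γ (parts.map blockWord).flatten [] ∧
      (parts.map (blockImg g)).flatten = y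

end ValencePaper

namespace ValencePaper

/-- `Γ⁻` (the loop-free version of `Γ`) is the 4-cycle on `u₁, v₁, u₂, v₂` with
edges `{u₁,u₂}, {u₁,v₂}, {v₁,u₂}, {v₁,v₂}`: the four vertices are pairwise
distinct, exhaust `V`, and adjacency between distinct vertices is exactly along
these four edges (self-loops arbitrary). -/
def IsC4Minus {V : Type} (Γ : GGraph V) (u₁ v₁ u₂ v₂ : V) : Prop :=
  (u₁ ≠ v₁ ∧ u₁ ≠ u₂ ∧ u₁ ≠ v₂ ∧ v₁ ≠ u₂ ∧ v₁ ≠ v₂ ∧ u₂ ≠ v₂) ∧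
  (∀ x : V, x = u₁ ∨ x = v₁ ∨ x = u₂ ∨ x = v₂) ∧
  (∀ x y : V, x ≠ y →
    (Γ.adj x y ↔ ({x, y} : Set V) = {u₁, u₂} ∨ ({x, y} : Set V) = {u₁, v₂} ∨
                 ({x, y} : Set V) = {v₁, u₂} ∨ ({x, y} : Set V) = {v₁, v₂}))

end ValencePaper

open ValencePaper

namespace ValencePaper

variable {V : Type}

section Congruence

theorem GEquiv.append_append (Γ : GGraph V) (s t : GWord V) {a b : GWord V} (h : GEquiv Γ a b) :
    GEquiv Γ (s ++ a ++ t) (s ++ b ++ t) := by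
  induction h with
  | rel x y h =>
    obtain ⟨s', t', h⟩ := h
    have := RStep.intro (s ++ s') (t' ++ t) h
    exact Relation.EqvGen.rel _ _ (by simpa [List.append_assoc] using this)
  | refl x => exact Relation.EqvGen.refl _
  | symm x y _ ih => exact ih.symm
  | trans x y z _ _ ih₁ ih₂ => exact ih₁.trans _ _ _ ih₂

/-- `≡_Γ` as a congruence on the free monoid over `X_Γ`. -/
def gcon (Γ : GGraph V) : Con (FreeMonoid (XLetter V)) where
  r a b := GEquiv Γ a.toList b.toList
  iseqv := ⟨fun _ => Relation.EqvGen.refl _, fun h => h.symm, fun h h' => h.trans _ _ _ h'⟩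
  mul' {a b c d} h h' := by
    have h₁ := GEquiv.append_append Γ [] c.toList h
    have h₂ := GEquiv.append_append Γ b.toList [] h'
    simp only [List.nil_append, List.append_nil] at h₁ h₂
    exact h₁.trans _ _ _ h₂

/-- The class of a letter in the quotient of the free monoid by `≡_Γ`. -/
def gletter (Γ : GGraph V) (x : XLetter V) : (gcon Γ).Quotient :=
  ((FreeMonoid.of x : FreeMonoid (XLetter V)) : (gcon Γ).Quotient)

theorem prod_map_gletter (Γ : GGraph V) (w : GWord V) :
    (w.map (gletter Γ)).prod = ((FreeMonoid.ofList w : FreeMonoid _) : (gcon Γ).Quotient) := by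
  induction w with
  | nil => rfl
  | cons x w ih => rw [List.map_cons, List.prod_cons, ih]; rfl

theorem prod_map_gletter_eq_iff (Γ : GGraph V) (a b : GWord V) :
    (a.map (gletter Γ)).prod = (b.map (gletter Γ)).prod ↔ GEquiv Γ a b := by
  rw [prod_map_gletter, prod_map_gletter, Con.eq]
  rfl

theorem gletter_inl_mul_inr (Γ : GGraph V) (v : V) :
    gletter Γ (Sum.inl v) * gletter Γ (Sum.inr v) = 1 := by
  have := (prod_map_gletter_eq_iff Γ [Sum.inl v, Sum.inr v] []).2
    (Relation.EqvGen.rel _ _ (by simpa using RStep.intro [] [] (R := GRules Γ) (Or.inl ⟨v, rfl⟩)))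
  simpa using this

theorem eq_inl_or_inr_vtx (x : XLetter V) : x = Sum.inl (vtx x) ∨ x = Sum.inr (vtx x) := by
  cases x <;> simp [vtx]

theorem commute_gletter (Γ : GGraph V) {x y : XLetter V} (h : Γ.adj (vtx x) (vtx y)) :
    Commute (gletter Γ x) (gletter Γ y) := by
  have := (prod_map_gletter_eq_iff Γ [x, y] [y, x]).2
    (Relation.EqvGen.rel _ _ (by
      simpa using RStep.intro [] [] (R := GRules Γ)
        (Or.inr ⟨vtx x, vtx y, x, y, eq_inl_or_inr_vtx x, eq_inl_or_inr_vtx y, h, rfl⟩)))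
  simpa [Commute, SemiconjBy] using this

theorem gletter_inr_mul_inl {Γ : GGraph V} {v : V} (h : Γ.adj v v) :
    gletter Γ (Sum.inr v) * gletter Γ (Sum.inl v) = 1 := by
  rw [← gletter_inl_mul_inr Γ v]
  exact (commute_gletter Γ (x := Sum.inr v) (y := Sum.inl v) h).eq

theorem GEquiv.prod_map_eq {Γ : GGraph V} {N : Type} [Monoid N] (f : XLetter V → N)
    (hinv : ∀ v, f (Sum.inl v) * f (Sum.inr v) = 1)
    (hcomm : ∀ x y, Γ.adj (vtx x) (vtx y) → Commute (f x) (f y))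
    {a b : GWord V} (h : GEquiv Γ a b) : (a.map f).prod = (b.map f).prod := by
  induction h with
  | rel x y h =>
    obtain ⟨s, t, h⟩ := h
    simp only [List.map_append, List.prod_append]
    congr 2
    rcases h with ⟨v, h⟩ | ⟨a, b, x, y, hx, hy, hab, h⟩
    · obtain ⟨rfl, rfl⟩ := Prod.mk.inj h
      simpa using hinv v
    · obtain ⟨rfl, rfl⟩ := Prod.mk.inj h
      have hx' : vtx x = a := by rcases hx with rfl | rfl <;> rfl
      have hy' : vtx y = b := by rcases hy with rfl | rfl <;> rfl
      simpa using (hcomm x y (by rwa [hx', hy'])).eq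
  | refl x => rfl
  | symm x y _ ih => exact ih.symm
  | trans x y z _ _ ih₁ ih₂ => exact ih₁.trans ih₂

theorem GEquiv.loopify {Γ : GGraph V} {a b : GWord V} (h : GEquiv Γ a b) :
    GEquiv (loopify Γ) a b := by
  rw [← prod_map_gletter_eq_iff]
  exact h.prod_map_eq _ (gletter_inl_mul_inr _) fun x y hxy => commute_gletter _ (Or.inl hxy)

end Congruence

section Lifting

/-- The part of a word over two copies of a two-letter signed alphabet in the copy `c`. -/
def component (c : Bool) (y : List (Bool × Bool × Bool)) : List (Bool × Bool) :=
  (y.filter (·.1 == c)).map Prod.snd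

variable {β N : Type} [Monoid N] (img : β → Bool × Bool × Bool) (μ : β → N)

theorem exists_lift_of_red
    (hinv : ∀ c b s, ∃ p p', img p = (c, b, s) ∧ img p' = (c, b, !s) ∧ μ p * μ p' = 1)
    (c : Bool) {l : List (Bool × Bool)} (h : FreeGroup.Red l []) :
    ∃ P : List β, P.map img = l.map (Prod.mk c) ∧ (P.map μ).prod = 1 := by
  induction h using Relation.ReflTransGen.head_induction_on with
  | refl => exact ⟨[], rfl, rfl⟩
  | head h _ ih =>
    obtain @⟨s, t, b, σ⟩ := h
    obtain ⟨P, hP, hμ⟩ := ih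
    rw [List.map_append, List.map_eq_append_iff] at hP
    obtain ⟨P₁, P₂, rfl, h₁, h₂⟩ := hP
    obtain ⟨p, p', hp, hp', hpp⟩ := hinv c b σ
    refine ⟨P₁ ++ p :: p' :: P₂, by simp [h₁, h₂, hp, hp'], ?_⟩
    simpa [← mul_assoc (μ p), hpp] using hμ

theorem exists_merge
    (hcomm : ∀ p p', (img p).1 ≠ (img p').1 → Commute (μ p) (μ p'))
    (y : List (Bool × Bool × Bool)) (P Q : List β)
    (hP : P.map img = (component false y).map (Prod.mk false))
    (hQ : Q.map img = (component true y).map (Prod.mk true)) :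
    ∃ R : List β, R.map img = y ∧ (R.map μ).prod = (P.map μ).prod * (Q.map μ).prod := by
  induction y generalizing P Q with
  | nil =>
    simp only [component, List.filter_nil, List.map_nil, List.map_eq_nil_iff] at hP hQ
    exact ⟨[], rfl, by simp [hP, hQ]⟩
  | cons q y ih =>
    obtain ⟨c, q⟩ := q
    cases c
    · simp only [component, List.filter_cons, beq_self_eq_true, if_true, List.map_cons,
        List.map_eq_cons_iff] at hP
      obtain ⟨p, P, rfl, hp, hP⟩ := hP
      obtain ⟨R, hR, hμ⟩ := ih P Q hP (by simpa [component, List.filter_cons] using hQ)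
      exact ⟨p :: R, by simp [hp, hR], by simp [hμ, mul_assoc]⟩
    · simp only [component, List.filter_cons, beq_self_eq_true, if_true, List.map_cons,
        List.map_eq_cons_iff] at hQ
      obtain ⟨p, Q, rfl, hp, hQ⟩ := hQ
      have hP' : P.map img = (component false y).map (Prod.mk false) := by
        simpa [component, List.filter_cons] using hP
      obtain ⟨R, hR, hμ⟩ := ih P Q hP' hQ
      refine ⟨p :: R, by simp [hp, hR], ?_⟩
      have : Commute (μ p) (P.map μ).prod := by
        refine Commute.list_prod_right _ _ fun z hz => ?_
        obtain ⟨p', hp', rfl⟩ := List.mem_map.1 hz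
        refine hcomm _ _ ?_
        have hmem : img p' ∈ P.map img := List.mem_map_of_mem hp'
        rw [hP'] at hmem
        obtain ⟨r, -, hr⟩ := List.mem_map.1 hmem
        simp [hp, ← hr]
      simp only [List.map_cons, List.prod_cons, hμ]
      rw [← mul_assoc, this.eq, mul_assoc]

theorem exists_lift
    (hinv : ∀ c b s, ∃ p p', img p = (c, b, s) ∧ img p' = (c, b, !s) ∧ μ p * μ p' = 1)
    (hcomm : ∀ p p', (img p).1 ≠ (img p').1 → Commute (μ p) (μ p'))
    (y : List (Bool × Bool × Bool)) (hy : ∀ c, FreeGroup.mk (component c y) = 1) :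
    ∃ P : List β, P.map img = y ∧ (P.map μ).prod = 1 := by
  have hred (c : Bool) : FreeGroup.Red (component c y) [] := by
    obtain ⟨l, h₁, h₂⟩ := FreeGroup.Red.exact.1 ((hy c).trans FreeGroup.one_eq_mk)
    rwa [FreeGroup.Red.nil_iff.1 h₂] at h₁
  obtain ⟨P, hP, hμP⟩ := exists_lift_of_red img μ hinv false (hred false)
  obtain ⟨Q, hQ, hμQ⟩ := exists_lift_of_red img μ hinv true (hred true)
  obtain ⟨R, hR, hμ⟩ := exists_merge img μ hcomm y P Q hP hQ
  exact ⟨R, hR, by rw [hμ, hμP, hμQ, one_mul]⟩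

end Lifting

section Code

/-- Positive words over two letters representing the letters of a free group of rank two:
the action `codePerm` turns `code p` into left multiplication by the letter `p`. -/
def code : Bool × Bool → List Bool
  | (false, true) => [false, false]
  | (true, true) => [true, false]
  | (false, false) => [true, false, false, true]
  | (true, false) => [false, true, false, false]

/-- The output produced by a letter when it is read in a state of `codePerm`. -/
def codeOut : Bool → Bool → FreeGroup Bool
  | false, false => 1
  | false, true => .of false
  | true, false => (.of false)⁻¹ * (.of true)⁻¹ * (.of false)⁻¹
  | true, true => .of true

/-- A letter switches the state and multiplies by its output. -/
def codePerm (b : Bool) : Equiv.Perm (Bool × FreeGroup Bool) where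
  toFun x := (!x.1, codeOut b x.1 * x.2)
  invFun x := (!x.1, (codeOut b !x.1)⁻¹ * x.2)
  left_inv x := by simp
  right_inv x := by simp

theorem prod_codePerm_code (p : Bool × Bool) (g : FreeGroup Bool) :
    ((code p).map codePerm).prod (false, g) = (false, FreeGroup.mk [p] * g) := by
  have hpos (b : Bool) : FreeGroup.mk [(b, true)] = FreeGroup.of b := rfl
  have hneg (b : Bool) : FreeGroup.mk [(b, false)] = (FreeGroup.of b)⁻¹ := rfl
  obtain ⟨_ | _, _ | _⟩ := p <;> simp [code, codePerm, codeOut, hpos, hneg, mul_assoc]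

end Code

section Cycle

variable (e : Bool × Bool ≃ V)

/-- The letter with component, vertex and sign given by `q`. -/
def indexLetter (q : Bool × Bool × Bool) : XLetter V :=
  if q.2.2 then Sum.inl (e (q.1, q.2.1)) else Sum.inr (e (q.1, q.2.1))

theorem vtx_indexLetter (q : Bool × Bool × Bool) : vtx (indexLetter e q) = e (q.1, q.2.1) := by
  unfold indexLetter
  split_ifs <;> rfl

theorem indexLetter_surjective : Function.Surjective (indexLetter e) := by
  rintro (v | v)
  · exact ⟨((e.symm v).1, (e.symm v).2, true), by simp [indexLetter]⟩
  · exact ⟨((e.symm v).1, (e.symm v).2, false), by simp [indexLetter]⟩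

theorem barL_indexLetter (c b s : Bool) :
    barL (indexLetter e (c, b, s)) = indexLetter e (c, b, !s) := by
  cases s <;> rfl

/-- The positive word in the block set representing the letter `q`. -/
def codeWord (q : Bool × Bool × Bool) : GWord V :=
  (code q.2).map fun b => Sum.inl (e (q.1, b))

theorem codeWord_injective : Function.Injective (codeWord e) := by
  rintro ⟨c, p⟩ ⟨c', p'⟩ h
  have h' : (code p).map (fun b => (c, b)) = (code p').map (fun b => (c', b)) := by
    have hinj : Function.Injective fun r : Bool × Bool => (Sum.inl (e r) : XLetter V) :=
      Sum.inl_injective.comp e.injective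
    apply List.map_injective_iff.2 hinj
    simpa [codeWord, Function.comp_def] using h
  clear h
  revert c p c' p'
  decide

/-- The letter represented by a signed block. -/
def blockLetter (p : (Bool × Bool × Bool) × Bool) : Bool × Bool × Bool :=
  if p.2 then p.1 else (p.1.1, p.1.2.1, !p.1.2.2)

theorem vtx_of_mem_blockWord {p : (Bool × Bool × Bool) × Bool} {x : XLetter V}
    (hx : x ∈ blockWord (codeWord e p.1, p.2)) : ∃ b, vtx x = e ((blockLetter p).1, b) := by
  obtain ⟨q, _ | _⟩ := p
  · simp only [blockWord, barW, codeWord, Bool.false_eq_true, if_false, List.mem_reverse,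
      List.mem_map, exists_exists_and_eq_and] at hx
    obtain ⟨b, -, rfl⟩ := hx
    exact ⟨b, rfl⟩
  · simp only [blockWord, codeWord, if_true, List.mem_map] at hx
    obtain ⟨b, -, rfl⟩ := hx
    exact ⟨b, rfl⟩

theorem prod_mul_prod_barW (Γ : GGraph V) (l : List V) :
    ((l.map Sum.inl).map (gletter Γ)).prod * ((barW (l.map Sum.inl)).map (gletter Γ)).prod = 1 := by
  induction l with
  | nil => simp [barW]
  | cons v l ih =>
    have : barW ((v :: l).map Sum.inl) = barW (l.map Sum.inl) ++ [Sum.inr v] := by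
      simp [barW, barL]
    rw [this]
    simp only [List.map_cons, List.prod_cons, List.map_append, List.prod_append, List.map_nil,
      List.prod_nil, mul_one]
    rw [mul_assoc, ← mul_assoc _ _ (gletter Γ (Sum.inr v)), ih, one_mul, gletter_inl_mul_inr]

section Component

variable {N : Type} [Group N] (c : Bool) (F : Bool → N)

/-- Evaluation of letters in a group through the component `c`, killing the other one. -/
def componentEval : XLetter V → N :=
  Sum.elim (fun v => if (e.symm v).1 = c then F (e.symm v).2 else 1)
    fun v => (if (e.symm v).1 = c then F (e.symm v).2 else 1)⁻¹

theorem componentEval_barL (x : XLetter V) :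
    componentEval e c F (barL x) = (componentEval e c F x)⁻¹ := by
  cases x <;> simp [componentEval, barL]

theorem prod_componentEval_barW (w : GWord V) :
    ((barW w).map (componentEval e c F)).prod = (w.map (componentEval e c F)).prod⁻¹ := by
  rw [List.prod_inv_reverse, barW, List.map_reverse, List.map_map, List.map_map]
  congr 3
  funext x
  exact componentEval_barL e c F x

theorem componentEval_of_ne {x : XLetter V} (h : (e.symm (vtx x)).1 ≠ c) :
    componentEval e c F x = 1 := by
  cases x <;> simpa [componentEval, vtx] using fun h' => absurd h' h

theorem GEquiv.prod_componentEval_eq {Γ : GGraph V}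
    (hadj : ∀ p q, p ≠ q → (Γ.adj (e p) (e q) ↔ p.1 ≠ q.1)) {a b : GWord V}
    (h : GEquiv (ValencePaper.loopify Γ) a b) :
    (a.map (componentEval e c F)).prod = (b.map (componentEval e c F)).prod := by
  refine h.prod_map_eq _ (fun v => by simp [componentEval]) fun x y hxy => ?_
  by_cases hv : vtx x = vtx y
  · rcases x with x | x <;> rcases y with y | y <;> obtain rfl : x = y := hv <;>
      simp [componentEval]
  · have hne : (e.symm (vtx x)).1 ≠ (e.symm (vtx y)).1 := by
      rw [← hadj _ _ (e.symm.injective.ne hv)]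
      simpa using hxy.resolve_right hv
    by_cases hx : (e.symm (vtx x)).1 = c
    · rw [componentEval_of_ne e c F (x := y) fun hy => hne (hx.trans hy.symm)]
      exact Commute.one_right _
    · rw [componentEval_of_ne e c F hx]
      exact Commute.one_left _

end Component

theorem prod_componentEval_of (c : Bool) (y : List (Bool × Bool × Bool)) :
    ((y.map (indexLetter e)).map (componentEval e c FreeGroup.of)).prod =
      FreeGroup.mk (component c y) := by
  induction y with
  | nil => rfl
  | cons q y ih =>
    obtain ⟨c', b, s⟩ := q
    rw [List.map_cons, List.map_cons, List.prod_cons, ih]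
    by_cases h : c' = c
    · have : component c ((c', b, s) :: y) = [(b, s)] ++ component c y := by
        simp [component, h]
      rw [this, ← FreeGroup.mul_mk]
      congr 1
      cases s <;> simp [indexLetter, componentEval, h] <;> rfl
    · rw [componentEval_of_ne _ _ _ (by simpa [vtx_indexLetter] using h), one_mul]
      simp [component, h]

theorem prod_codePerm_blockWord (c : Bool) (p : (Bool × Bool × Bool) × Bool) (g : FreeGroup Bool) :
    ((blockWord (codeWord e p.1, p.2)).map (componentEval e c codePerm)).prod (false, g) =
      (false, componentEval e c FreeGroup.of (indexLetter e (blockLetter p)) * g) := by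
  have hpos (q : Bool × Bool × Bool) (g : FreeGroup Bool) :
      ((codeWord e q).map (componentEval e c codePerm)).prod (false, g) =
        (false, componentEval e c FreeGroup.of (indexLetter e q) * g) := by
    by_cases h : q.1 = c
    · have h₁ : (codeWord e q).map (componentEval e c codePerm) = (code q.2).map codePerm := by
        simp [codeWord, componentEval, h]
      have h₂ : componentEval e c FreeGroup.of (indexLetter e q) = FreeGroup.mk [q.2] := by
        obtain ⟨c', b, _ | _⟩ := q <;> simp [indexLetter, componentEval, show c' = c from h] <;> rfl
      rw [h₁, h₂, prod_codePerm_code]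
    · have h₁ : (codeWord e q).map (componentEval e c codePerm) = (code q.2).map fun _ => 1 := by
        rw [codeWord, List.map_map]
        refine List.map_congr_left fun b _ => componentEval_of_ne _ _ _ ?_
        simpa [vtx] using h
      rw [h₁, componentEval_of_ne _ _ _ (by simpa [vtx_indexLetter] using h)]
      simp
  obtain ⟨⟨c', b, s⟩, _ | _⟩ := p
  · simp only [blockWord, blockLetter, Bool.false_eq_true, if_false]
    rw [prod_componentEval_barW, Equiv.Perm.inv_eq_iff_eq, hpos, ← barL_indexLetter,
      componentEval_barL, mul_inv_cancel_left]
  · exact hpos _ _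

theorem prod_codePerm_flatten (c : Bool) (P : List ((Bool × Bool × Bool) × Bool)) :
    (((P.map fun p => blockWord (codeWord e p.1, p.2)).flatten).map
        (componentEval e c codePerm)).prod (false, 1) =
      (false, (((P.map blockLetter).map (indexLetter e)).map
        (componentEval e c FreeGroup.of)).prod) := by
  induction P with
  | nil => rfl
  | cons p P ih =>
    simp only [List.map_cons, List.flatten_cons, List.map_append, List.prod_append,
      List.prod_cons, Equiv.Perm.mul_apply, ih, prod_codePerm_blockWord]

theorem exists_blocks_of_component {Γ : GGraph V}
    (hadj : ∀ p q, p ≠ q → (Γ.adj (e p) (e q) ↔ p.1 ≠ q.1))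
    (y : List (Bool × Bool × Bool))
    (hy : ∀ c, FreeGroup.mk (component c y) = 1) :
    ∃ P : List ((Bool × Bool × Bool) × Bool), P.map blockLetter = y ∧
      GEquiv Γ (P.map fun p => blockWord (codeWord e p.1, p.2)).flatten [] := by
  obtain ⟨P, hP, hμ⟩ := exists_lift blockLetter
    (fun p => ((blockWord (codeWord e p.1, p.2)).map (gletter Γ)).prod)
    (fun c b s => ⟨((c, b, s), true), ((c, b, s), false), rfl, rfl, by
      simpa [blockWord, codeWord, Function.comp_def] using
        prod_mul_prod_barW Γ ((code (b, s)).map fun b => e (c, b))⟩)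
    (fun p p' hne => by
      refine Commute.list_prod_left _ _ fun z hz => Commute.list_prod_right _ _ fun z' hz' => ?_
      obtain ⟨x, hx, rfl⟩ := List.mem_map.1 hz
      obtain ⟨x', hx', rfl⟩ := List.mem_map.1 hz'
      obtain ⟨b, hb⟩ := vtx_of_mem_blockWord e hx
      obtain ⟨b', hb'⟩ := vtx_of_mem_blockWord e hx'
      refine commute_gletter Γ ?_
      rw [hb, hb']
      exact (hadj _ _ fun h => hne (Prod.mk.inj h).1).2 hne) y hy
  refine ⟨P, hP, (prod_map_gletter_eq_iff Γ _ _).1 ?_⟩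
  rw [List.map_flatten, List.prod_flatten, List.map_map, List.map_map]
  exact hμ

theorem gequiv_loopify_nil_iff {Γ : GGraph V}
    (hadj : ∀ p q, p ≠ q → (Γ.adj (e p) (e q) ↔ p.1 ≠ q.1))
    (y : List (Bool × Bool × Bool)) :
    GEquiv (loopify Γ) (y.map (indexLetter e)) [] ↔
      ∀ c, FreeGroup.mk (component c y) = 1 := by
  refine ⟨fun h c => ?_, fun hy => ?_⟩
  · rw [← prod_componentEval_of e, h.prod_componentEval_eq e c _ hadj]
    rfl
  · obtain ⟨P, hP, hμ⟩ := exists_lift id (fun q => gletter (loopify Γ) (indexLetter e q))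
      (fun c b s => ⟨(c, b, s), (c, b, !s), rfl, rfl, by
        cases s
        · exact gletter_inr_mul_inl (Or.inr rfl)
        · exact gletter_inl_mul_inr _ _⟩)
      (fun p p' hne => by
        refine commute_gletter _ (Or.inl ?_)
        rw [vtx_indexLetter, vtx_indexLetter]
        exact (hadj _ _ fun h => hne (Prod.mk.inj h).1).2 hne) y hy
    obtain rfl : P = y := by simpa using hP
    rw [← prod_map_gletter_eq_iff, List.map_map]
    exact hμ

theorem simulatesLoopify_codeWord {Γ : GGraph V}
    (hadj : ∀ p q, p ≠ q → (Γ.adj (e p) (e q) ↔ p.1 ≠ q.1))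
    (d : GWord V → XLetter V) :
    SimulatesLoopify Γ (Set.range (codeWord e))
      (Function.extend (codeWord e) (indexLetter e) d) := by
  have himg (P : List ((Bool × Bool × Bool) × Bool)) :
      ((P.map fun p => (codeWord e p.1, p.2)).map
        (blockImg (Function.extend (codeWord e) (indexLetter e) d))).flatten =
        (P.map blockLetter).map (indexLetter e) := by
    induction P with
    | nil => rfl
    | cons p P ih =>
      simp only [List.map_cons, List.flatten_cons, ih]
      obtain ⟨⟨c, b, s⟩, _ | _⟩ := p <;>
        simp [blockImg, blockLetter, (codeWord_injective e).extend_apply, barL_indexLetter]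
  intro y
  constructor
  · intro h
    obtain ⟨y, rfl⟩ := List.map_surjective_iff.2 (indexLetter_surjective e) y
    obtain ⟨P, hP, hΓ⟩ :=
      exists_blocks_of_component e hadj y ((gequiv_loopify_nil_iff e hadj y).1 h)
    refine ⟨P.map fun p => (codeWord e p.1, p.2), ?_, ?_, ?_⟩
    · intro p hp
      obtain ⟨q, -, rfl⟩ := List.mem_map.1 hp
      exact ⟨q.1, rfl⟩
    · rwa [List.map_map]
    · rw [himg, hP]
  · rintro ⟨parts, hW, hΓ, rfl⟩
    obtain ⟨P, rfl⟩ : ∃ P : List ((Bool × Bool × Bool) × Bool),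
        P.map (fun p => (codeWord e p.1, p.2)) = parts := by
      rw [← Set.mem_range, Set.range_list_map]
      intro p hp
      obtain ⟨q, hq⟩ := hW p hp
      exact ⟨(q, p.2), by simp [hq]⟩
    rw [himg, gequiv_loopify_nil_iff e hadj]
    intro c
    have h := prod_codePerm_flatten e c P
    rw [List.map_map] at hΓ
    rw [show (P.map fun p => blockWord (codeWord e p.1, p.2)) =
      P.map (blockWord ∘ fun p => (codeWord e p.1, p.2)) from rfl,
      hΓ.loopify.prod_componentEval_eq e c _ hadj, prod_componentEval_of] at h
    exact (congrArg Prod.snd h).symm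

end Cycle

theorem IsC4Minus.exists_equiv {Γ : GGraph V} {u₁ v₁ u₂ v₂ : V} (h : IsC4Minus Γ u₁ v₁ u₂ v₂) :
    ∃ e : Bool × Bool ≃ V, ∀ p q, p ≠ q → (Γ.adj (e p) (e q) ↔ p.1 ≠ q.1) := by
  obtain ⟨⟨h₁, h₂, h₃, h₄, h₅, h₆⟩, hV, hadj⟩ := h
  let f : Bool × Bool → V := fun p =>
    bif p.1 then bif p.2 then v₂ else u₂ else bif p.2 then v₁ else u₁
  have hf : Function.Bijective f := by
    constructor
    · rintro ⟨_ | _, _ | _⟩ ⟨_ | _, _ | _⟩ h <;> simp_all [f]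
    · intro x
      rcases hV x with rfl | rfl | rfl | rfl
      exacts [⟨(false, false), rfl⟩, ⟨(false, true), rfl⟩, ⟨(true, false), rfl⟩,
        ⟨(true, true), rfl⟩]
  refine ⟨Equiv.ofBijective f hf, fun p q hpq => ?_⟩
  rw [Equiv.ofBijective_apply, Equiv.ofBijective_apply, hadj _ _ (hf.1.ne hpq)]
  simp only [Set.pair_eq_pair_iff]
  obtain ⟨_ | _, _ | _⟩ := p <;> obtain ⟨_ | _, _ | _⟩ := q <;>
    simp [f, h₁, h₂, h₃, h₄, h₅, h₆, h₁.symm, h₂.symm, h₃.symm, h₄.symm, h₅.symm, h₆.symm] at hpq ⊢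

end ValencePaper

/-- Let `Γ` be a graph on four vertices whose loop-free version `Γ⁻`
is the 4-cycle with edges `{u₁,u₂}, {u₁,v₂}, {v₁,u₂}, {v₁,v₂}`. Then there are a
finite set `W ⊆ X_Γ*` and a morphism `φ : (W ∪ W̄)* → X_Γ*` (given by a letter
`g w ∈ X_Γ` for each `w ∈ W`, with `φ(w̄) = φ(w)‾`) such that for all `y ∈ X_Γ*`:
`y ≡_{Γ°} ε` iff there is `x ∈ (W ∪ W̄)*` with `x ≡_Γ ε` and `φ(x) = y`. -/
theorem simulate_looped_c4 {V : Type} (Γ : GGraph V) (u₁ v₁ u₂ v₂ : V)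
    (hC4 : IsC4Minus Γ u₁ v₁ u₂ v₂) :
    ∃ (W : Set (GWord V)) (g : GWord V → XLetter V),
      W.Finite ∧ SimulatesLoopify Γ W g := by
  obtain ⟨e, he⟩ := hC4.exists_equiv
  exact ⟨_, _, Set.finite_range (codeWord e), simulatesLoopify_codeWord e he fun _ => Sum.inl u₁⟩
end

section
/- Let Γ be a graph whose loop-free version Γ⁻ is the 4-cycle on {u₁, v₁, u₂, v₂} with edges {u₁,u₂}, {u₁,v₂}, {v₁,u₂}, {v₁,v₂}, and let W ⊆ X_Γ* and φ : (W ∪ W̄)* → X_Γ* be as guaranteed by the simulation lemma (φ(w) ∈ X_Γ for w ∈ W, φ(w̄) = φ(w)‾, and y ≡_{Γ°} ε iff ∃x ∈ (W ∪ W̄)* with x ≡_Γ ε and φ(x) = y). Let A be a bidirected valence system over Γ° in which every transition is labeled by a single letter of X_Γ, with states s, t, and let B be the valence system over Γ obtained from A by replacing every transition p →v q (v ∈ X_Γ) by the transitions p →w q for all w ∈ W with φ(w) = v. Then B is bidirected, and there exists a run s →x t in B with x ≡_Γ ε if and only if there exists a run s →y t in A with y ≡_{Γ°} ε. -/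
open scoped Classical

namespace ValencePaper

variable {V Q : Type}

theorem barL_barL (a : XLetter V) : barL (barL a) = a := by
  cases a <;> rfl

theorem barW_barW (w : GWord V) : barW (barW w) = w := by
  simp [barW, Function.comp_def, barL_barL]

/-- The signed block denoting the inverse word. -/
def barBlock (b : GWord V × Bool) : GWord V × Bool := (b.1, !b.2)

theorem blockWord_barBlock (b : GWord V × Bool) : blockWord (barBlock b) = barW (blockWord b) := by
  obtain ⟨w, _ | _⟩ := b <;> simp [barBlock, blockWord, barW_barW]

theorem blockImg_barBlock (g : GWord V → XLetter V) (b : GWord V × Bool) :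
    blockImg g (barBlock b) = barW (blockImg g b) := by
  obtain ⟨w, _ | _⟩ := b <;> simp [barBlock, blockImg, barW, barL_barL]

/-- The transitions obtained from `E` by replacing every label `φ(b)` by each block `b`. -/
def replaceBlocks (W : Set (GWord V)) (g : GWord V → XLetter V) (E : Set (Q × GWord V × Q)) :
    Set (Q × GWord V × Q) :=
  {x | ∃ b : GWord V × Bool, b.1 ∈ W ∧ blockWord b = x.2.1 ∧ (x.1, blockImg g b, x.2.2) ∈ E}

variable {W : Set (GWord V)} {g : GWord V → XLetter V} {E : Set (Q × GWord V × Q)}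

theorem replaceBlocks_eq :
    replaceBlocks W g E = {x | ∃ a : XLetter V, (x.1, [a], x.2.2) ∈ E ∧
      ((x.2.1 ∈ W ∧ g x.2.1 = a) ∨ (∃ w' ∈ W, x.2.1 = barW w' ∧ barL (g w') = a))} := by
  ext ⟨p, w, q⟩
  constructor
  · rintro ⟨⟨w', _ | _⟩, hw', rfl, h⟩
    · exact ⟨_, h, Or.inr ⟨w', hw', rfl, rfl⟩⟩
    · exact ⟨_, h, Or.inl ⟨hw', rfl⟩⟩
  · rintro ⟨a, h, ⟨hw, rfl⟩ | ⟨w', hw', hw, rfl⟩⟩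
    · exact ⟨(w, true), hw, rfl, h⟩
    · exact ⟨(w', false), hw', hw.symm, h⟩

theorem Bidirected.replaceBlocks (hE : Bidirected E) : Bidirected (replaceBlocks W g E) := by
  rintro p w q ⟨b, hb, rfl, h⟩
  refine ⟨barBlock b, hb, blockWord_barBlock b, ?_⟩
  rw [blockImg_barBlock]
  exact hE _ _ _ h

theorem Run.exists_blocks {p q : Q} {x : GWord V} (h : Run (replaceBlocks W g E) p x q) :
    ∃ parts : List (GWord V × Bool), (∀ b ∈ parts, b.1 ∈ W) ∧
      (parts.map blockWord).flatten = x ∧ Run E p (parts.map (blockImg g)).flatten q := by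
  induction h with
  | nil q => exact ⟨[], by simp, rfl, Run.nil q⟩
  | cons h _ ih =>
    obtain ⟨b, hb, rfl, hE⟩ := h
    obtain ⟨parts, hW, rfl, hrun⟩ := ih
    exact ⟨b :: parts, List.forall_mem_cons.2 ⟨hb, hW⟩, by simp,
      Run.cons hE hrun⟩

theorem exists_blockImg_eq_singleton (g : GWord V → XLetter V) (b : GWord V × Bool) :
    ∃ a, blockImg g b = [a] := by
  obtain ⟨w, _ | _⟩ := b
  exacts [⟨_, rfl⟩, ⟨_, rfl⟩]

theorem Run.replaceBlocks (hE : ∀ x ∈ E, ∃ a : XLetter V, x.2.1 = [a]) {p q : Q} {y : GWord V}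
    (h : Run E p y q) (parts : List (GWord V × Bool)) (hW : ∀ b ∈ parts, b.1 ∈ W)
    (hy : (parts.map (blockImg g)).flatten = y) :
    Run (replaceBlocks W g E) p (parts.map blockWord).flatten q := by
  induction h generalizing parts with
  | nil q =>
    cases parts with
    | nil => exact Run.nil q
    | cons b parts =>
      obtain ⟨a, ha⟩ := exists_blockImg_eq_singleton g b
      simp [ha] at hy
  | cons h _ ih =>
    obtain ⟨a, rfl⟩ := hE _ h
    cases parts with
    | nil => simp at hy
    | cons b parts =>
      obtain ⟨c, hc⟩ := exists_blockImg_eq_singleton g b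
      simp only [List.map_cons, List.flatten_cons, hc, List.singleton_append,
        List.cons.injEq] at hy
      obtain ⟨rfl, hy⟩ := hy
      exact Run.cons ⟨b, hW b (by simp), rfl, hc ▸ h⟩
        (ih parts (fun d hd => hW d (List.mem_cons_of_mem b hd)) hy)

end ValencePaper

open ValencePaper

/-- Let `Γ⁻` be the 4-cycle, and let `W`, `φ` (given by `g`) be as
in the simulation lemma. Let `A` be a bidirected valence system over `Γ°` whose
transitions are labeled by single letters of `X_Γ`, with states `s, t`, and let
`B` (over `Γ`) be obtained by replacing every transition `p →a q` of `A` by the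
transitions `p →w q` for all blocks `w ∈ W ∪ W̄` with `φ(w) = a`. Then `B` is
bidirected, and there is a run `s →x t` in `B` with `x ≡_Γ ε` iff there is a run
`s →y t` in `A` with `y ≡_{Γ°} ε`. -/
theorem replacement_system_bidirected_and_equivalent {V Q : Type} [Finite Q]
    (Γ : GGraph V) (u₁ v₁ u₂ v₂ : V) (hC4 : IsC4Minus Γ u₁ v₁ u₂ v₂)
    (W : Set (GWord V)) (hWfin : W.Finite) (g : GWord V → XLetter V)
    (hsim : SimulatesLoopify Γ W g)
    (EA : Set (Q × GWord V × Q)) (hEAfin : EA.Finite) (hbiA : Bidirected EA)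
    (hsingle : ∀ x ∈ EA, ∃ a : XLetter V, x.2.1 = [a]) (s t : Q) :
    ∀ EB : Set (Q × GWord V × Q),
      EB = {x | ∃ a : XLetter V, (x.1, [a], x.2.2) ∈ EA ∧
        ((x.2.1 ∈ W ∧ g x.2.1 = a) ∨
         (∃ w' ∈ W, x.2.1 = barW w' ∧ barL (g w') = a))} →
      Bidirected EB ∧
      ((∃ x, Run EB s x t ∧ GEquiv Γ x []) ↔
       (∃ y, Run EA s y t ∧ GEquiv (loopify Γ) y [])) := by
  rintro EB hEB
  rw [← replaceBlocks_eq] at hEB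
  subst hEB
  refine ⟨hbiA.replaceBlocks, ?_, ?_⟩
  · rintro ⟨x, hrun, hx⟩
    obtain ⟨parts, hW, rfl, hrunA⟩ := hrun.exists_blocks
    exact ⟨_, hrunA, (hsim _).2 ⟨parts, hW, hx, rfl⟩⟩
  · rintro ⟨y, hrun, hy⟩
    obtain ⟨parts, hW, hx, himg⟩ := (hsim y).1 hy
    exact ⟨_, hrun.replaceBlocks hsingle parts hW himg, hx⟩
end

section
/- Let Γ ∈ SC± have an unlooped vertex adjacent to all other vertices, with decomposition tree t, let A be a valence system over Γ, and define the saturation sequence R^(0) = ∅, R^(i+1) = { τ ∈ ρ(A) : W^{R^(i)}_τ ∩ Z_τ ≠ ∅ }; since R^(0) ⊆ R^(1) ⊆ ⋯ ⊆ ρ(A), there is n with R^(n+1) = R^(n). Then for every placeholder τ ∈ ρ(A), W^{R^(n)}_τ = W_τ. -/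
open scoped Classical

namespace ValencePaper

variable {V Q : Type}

/-- Rooted trees whose nodes carry sets of vertices (decomposition trees). -/
inductive DTree (V : Type) where
  | node : Set V → List (DTree V) → DTree V

/-- The set of vertices carried by the root node. -/
def rootSet : DTree V → Set V
  | .node U _ => U

/-- The immediate subtrees. -/
def childrenOf : DTree V → List (DTree V)
  | .node _ cs => cs

/-- `IsSubtree s t`: `s` is a subtree of `t`. -/
inductive IsSubtree : DTree V → DTree V → Prop
  | refl (t : DTree V) : IsSubtree t t
  | child {s c : DTree V} {U : Set V} {cs : List (DTree V)} :
      c ∈ cs → IsSubtree s c → IsSubtree s (.node U cs)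

/-- `s` is a strict subtree of `r` (contained in some child of `r`). -/
def StrictSubtree (s r : DTree V) : Prop := ∃ c ∈ childrenOf r, IsSubtree s c

/-- The vertices carried by the nodes of a tree. -/
def treeVerts (s : DTree V) : Set V := {x | ∃ r, IsSubtree r s ∧ x ∈ rootSet r}

/-- The vertices carried by strict ancestors (within the ambient tree `t`)
of the root of the subtree `s`. -/
def ancVerts (t s : DTree V) : Set V :=
  {x | ∃ r, IsSubtree r t ∧ StrictSubtree s r ∧ x ∈ rootSet r}

/-- `V_s`: vertices belonging to the subtree `s` or to an ancestor of its root. -/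
def Vfull (t s : DTree V) : Set V := treeVerts s ∪ ancVerts t s

/-- A node description `s^x` is a pair of a subtree and a flag:
`(s, true)` is `rt(s)` and `(s, false)` is `nort(s)`. -/
abbrev NodeDesc (V : Type) := DTree V × Bool

/-- `V̌_{s^x}`: for `rt(s)` all vertices of `s`; for `nort(s)` the vertices of `s`
outside its root. -/
def Vcheck (sx : NodeDesc V) : Set V :=
  if sx.2 then treeVerts sx.1 else treeVerts sx.1 \ rootSet sx.1

/-- `V̂_{s^x} = V_s ∖ V̌_{s^x}`. -/
def Vhat (t : DTree V) (sx : NodeDesc V) : Set V := Vfull t sx.1 \ Vcheck sx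

/-- `r^x` is above `s^y`. -/
def Above (rx sy : NodeDesc V) : Prop :=
  StrictSubtree sy.1 rx.1 ∨ (rx.1 = sy.1 ∧ rx.2 = true ∧ sy.2 = false)

/-- The transition set of `A_s`: transitions whose label only uses vertices in `S`. -/
def restrictE (E : Set (Q × GWord V × Q)) (S : Set V) : Set (Q × GWord V × Q) :=
  {x ∈ E | ∀ a ∈ x.2.1, vtx a ∈ S}

/-- The subgraph of `Γ` induced by a vertex set `U`. -/
def induceG (Γ : GGraph V) (U : Set V) : GGraph V :=
  ⟨fun a b => a ∈ U ∧ b ∈ U ∧ Γ.adj a b, fun a b h => ⟨h.2.1, h.1, Γ.symm a b h.2.2⟩⟩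

/-- Projection of a word to the letters over a vertex set `U`. -/
noncomputable def projTo (U : Set V) : GWord V → GWord V
  | [] => []
  | a :: w => if vtx a ∈ U then a :: projTo U w else projTo U w

/-- `π̌_U(w) = 1`: the projection of `w` to the letters over `U` is trivial in the
graph monoid of the subgraph induced by `U`. -/
def ProjOne (Γ : GGraph V) (U : Set V) (w : GWord V) : Prop :=
  GEquiv (induceG Γ U) (projTo U w) []

/-- The signed contribution of a letter to the count of the vertex `x`. -/
noncomputable def zval (x : V) : XLetter V → ℤ :=
  Sum.elim (fun y => if y = x then 1 else 0) (fun y => if y = x then -1 else 0)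

/-- `π̂_Y(w) ∈ ℤ^Y`: for `v ∈ Y`, occurrences of `v` minus occurrences of `v̄`
in `w` (and `0` outside `Y`). -/
noncomputable def pihat (Y : Set V) (w : GWord V) : V → ℤ :=
  fun x => if x ∈ Y then (w.map (zval x)).sum else 0

/-- Placeholders `(p, s^x, q)`. -/
abbrev PhT (Q V : Type) := Q × NodeDesc V × Q

/-- The effect space `ℕ^{ρ(A)} ⊕ ℤ^V`. -/
abbrev EffT (Q V : Type) := (PhT Q V → ℕ) × (V → ℤ)

/-- The unit vector of a placeholder in `ℕ^{ρ(A)}`. -/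
noncomputable def phUnit (τ : PhT Q V) : PhT Q V → ℕ := fun x => if x = τ then 1 else 0

/-- A placeholder sequence from `p` to `r`: an alternation
`σ₀ τ₁ σ₁ ⋯ τ_m σ_m` of runs over `E` and placeholders satisfying `Ok`;
`w` is the concatenation of the labels of the runs `σ_i` and `c ∈ ℕ^{ρ(A)}`
counts the placeholders used. -/
inductive PSeq (E : Set (Q × GWord V × Q)) (Ok : PhT Q V → Prop) :
    Q → GWord V → (PhT Q V → ℕ) → Q → Prop
  | base {p : Q} {w : GWord V} {q : Q} : Run E p w q → PSeq E Ok p w (fun _ => 0) q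
  | cons {p : Q} {w : GWord V} {q : Q} {d : NodeDesc V} {q' : Q} {u : GWord V}
      {c : PhT Q V → ℕ} {r : Q} :
      Run E p w q → Ok (q, d, q') → PSeq E Ok q' u c r →
      PSeq E Ok p (w ++ u) (c + phUnit (q, d, q')) r

/-- `e` is the effect of an `R`-placeholder run in `(p, s^x, q)`:
a placeholder sequence over `A_s` using placeholders from `R` whose node
descriptions are above `s^x`, whose run labels are trivial when projected to
`V̌_{s^x}`; the effect is the placeholder count together with `π̂_{s^x}` of the
run labels. -/
def IsPRunEff (Γ : GGraph V) (t : DTree V) (E : Set (Q × GWord V × Q))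
    (R : Set (PhT Q V)) (p : Q) (sx : NodeDesc V) (q : Q) (e : EffT Q V) : Prop :=
  ∃ (w : GWord V) (c : PhT Q V → ℕ),
    PSeq (restrictE E (Vfull t sx.1)) (fun ph => ph ∈ R ∧ Above ph.2.1 sx) p w c q ∧
    ProjOne Γ (Vcheck sx) w ∧ e = (c, pihat (Vhat t sx) w)

/-- `e` is the effect of an almost `R`-placeholder run in `(p, s^x, q)`:
placeholders may also have node description equal to `s^x`, and only the
projection to `V̌_{nort(s)}` has to be trivial (effects use `π̂_{nort(s)}`). -/
def AlmostPRunEff (Γ : GGraph V) (t : DTree V) (E : Set (Q × GWord V × Q))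
    (R : Set (PhT Q V)) (p : Q) (sx : NodeDesc V) (q : Q) (e : EffT Q V) : Prop :=
  ∃ (w : GWord V) (c : PhT Q V → ℕ),
    PSeq (restrictE E (Vfull t sx.1))
      (fun ph => ph ∈ R ∧ (Above ph.2.1 sx ∨ ph.2.1 = sx)) p w c q ∧
    ProjOne Γ (Vcheck (sx.1, false)) w ∧ e = (c, pihat (Vhat t (sx.1, false)) w)

/-- Realizability of placeholders: `τ` is realizable if there is an
`R`-placeholder run in `τ` for some set `R` of realizable placeholders. -/
inductive Realizable (Γ : GGraph V) (t : DTree V) (E : Set (Q × GWord V × Q)) :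
    PhT Q V → Prop
  | intro (τ : PhT Q V) (R : Set (PhT Q V)) :
      (∀ τ' ∈ R, Realizable Γ t E τ') →
      (∃ e, IsPRunEff Γ t E R τ.1 τ.2.1 τ.2.2 e) →
      Realizable Γ t E τ

/-- `E_τ`: the set of effects of realizable placeholder runs in `τ`. -/
def ESet (Γ : GGraph V) (t : DTree V) (E : Set (Q × GWord V × Q)) (τ : PhT Q V) :
    Set (EffT Q V) :=
  {e | ∃ R : Set (PhT Q V), (∀ τ' ∈ R, Realizable Γ t E τ') ∧
        IsPRunEff Γ t E R τ.1 τ.2.1 τ.2.2 e}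

/-- Connectivity within a vertex set `T` (via edges of `Γ` inside `T`). -/
def ConnIn (Γ : GGraph V) (T : Set V) : V → V → Prop :=
  Relation.ReflTransGen (fun a b => a ∈ T ∧ b ∈ T ∧ Γ.adj a b)

/-- `C` is a connected component of the subgraph induced by `T`. -/
def IsComponent (Γ : GGraph V) (T C : Set V) : Prop :=
  C.Nonempty ∧ C ⊆ T ∧ (∀ x ∈ C, ∀ y ∈ C, ConnIn Γ T x y) ∧
    (∀ x ∈ C, ∀ y ∈ T, ConnIn Γ T x y → y ∈ C)

/-- The set of vertices of `S` adjacent (in `Γ`) to all other vertices of `S`. -/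
def univSet (Γ : GGraph V) (S : Set V) : Set V :=
  {v | v ∈ S ∧ ∀ w ∈ S, w ≠ v → Γ.adj v w}

/-- `t` is the decomposition tree of the subgraph of `Γ` induced by `S`. -/
inductive IsDecompOf (Γ : GGraph V) : Set V → DTree V → Prop
  | leaf (S : Set V) (h : ∀ v ∈ S, ∀ w ∈ S, w ≠ v → Γ.adj v w) :
      IsDecompOf Γ S (.node S [])
  | internal (S : Set V) (cs : List (DTree V))
      (hne : univSet Γ S ≠ S)
      (hcs : ∀ c ∈ cs, IsDecompOf Γ (treeVerts c) c)
      (hcomp : ∀ c ∈ cs, IsComponent Γ (S \ univSet Γ S) (treeVerts c))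
      (hcover : ∀ x ∈ S \ univSet Γ S, ∃ c ∈ cs, x ∈ treeVerts c)
      (hdisj : cs.Pairwise fun c d => Disjoint (treeVerts c) (treeVerts d)) :
      IsDecompOf Γ S (.node (univSet Γ S) cs)

/-- Transitive forests: built from the empty graph by disjoint unions and by
adding a vertex adjacent to all existing vertices (on induced subgraphs). -/
inductive IsTF (Γ : GGraph V) : Set V → Prop
  | empty : IsTF Γ ∅
  | union {S₁ S₂ : Set V} : IsTF Γ S₁ → IsTF Γ S₂ → Disjoint S₁ S₂ →
      (∀ x ∈ S₁, ∀ y ∈ S₂, ¬ Γ.adj x y) → IsTF Γ (S₁ ∪ S₂)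
  | addUniv {S : Set V} {v : V} : IsTF Γ S → v ∉ S →
      (∀ w ∈ S, Γ.adj v w) → IsTF Γ (insert v S)

/-- PVASS-freeness: the neighborhood of every unlooped vertex is a clique. -/
def PVASSFree (Γ : GGraph V) : Prop :=
  ∀ v, ¬ Γ.adj v v → ∀ x y, Γ.adj v x → Γ.adj v y → x ≠ y → Γ.adj x y

/-- `Γ ∈ SC±`: a PVASS-free transitive forest. -/
def InSCpm (Γ : GGraph V) : Prop := PVASSFree Γ ∧ IsTF Γ Set.univ

end ValencePaper

namespace ValencePaper

variable {V Q : Type}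

/-- `Z_{r^x}`: effects that vanish on `V̌_{r^x}` and on all placeholders whose
node description is below or equal to `r^x`. -/
def Zset (rx : NodeDesc V) : Set (EffT Q V) :=
  {e | (∀ v ∈ Vcheck rx, e.2 v = 0) ∧
       (∀ (p q : Q) (sy : NodeDesc V), Above rx sy ∨ sy = rx → e.1 (p, sy, q) = 0)}

/-- `Y_{r^x}`: the intersection of all `Z_{s^y}` with `s^y` below `r^x`. -/
def Yset (rx : NodeDesc V) : Set (EffT Q V) :=
  {e | ∀ sy : NodeDesc V, Above rx sy → e ∈ Zset sy}

/-- The family `(W_τ)_{τ ∈ ρ(A)}`: the smallest family such that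
(1) for a leaf `s` and any `R` consisting of placeholders `τ` (over subtrees
of `t`) with `W_τ ∩ Z_τ ≠ ∅`, all effects of almost `R`-placeholder runs
belong to `W_{(p, nort(s), q)}`;
(2) if `r^x` is above `s^y` and `W_{(p,s^y,q)} ∩ Z_{s^y} ≠ ∅`, then
`W_{(p,s^y,q)} ∩ Y_{r^x} ⊆ W_{(p,r^x,q)}`;
(3) if `r^x` is above `s^y` and `W_{(p,r^x,q)} ∩ Z_{r^x} ≠ ∅`, then the unit
vector of `(p,r^x,q)` belongs to `W_{(p,s^y,q)}`;
(4) if `(p',r^x,q') + u ∈ W_{(p,r^x,q)}` and `v ∈ W_{(p',r^x,q')}`, then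
`v + u ∈ W_{(p,r^x,q)}`.
(The nonemptiness side conditions are expressed via explicit witnesses.) -/
inductive WSet (Γ : GGraph V) (t : DTree V) (E : Set (Q × GWord V × Q)) :
    PhT Q V → EffT Q V → Prop
  | leaf {p q : Q} {s : DTree V} {R : Set (PhT Q V)} (wit : PhT Q V → EffT Q V)
      {e : EffT Q V} :
      IsSubtree s t → childrenOf s = [] →
      (∀ τ' ∈ R, IsSubtree τ'.2.1.1 t ∧ wit τ' ∈ Zset τ'.2.1) →
      (∀ τ' ∈ R, WSet Γ t E τ' (wit τ')) →
      AlmostPRunEff Γ t E R p (s, false) q e →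
      WSet Γ t E (p, (s, false), q) e
  | up {p q : Q} {rx sy : NodeDesc V} (e₀ : EffT Q V) {e : EffT Q V} :
      IsSubtree rx.1 t → Above rx sy →
      e₀ ∈ Zset sy → WSet Γ t E (p, sy, q) e₀ →
      WSet Γ t E (p, sy, q) e → e ∈ Yset rx →
      WSet Γ t E (p, rx, q) e
  | down {p q : Q} {rx sy : NodeDesc V} (e₀ : EffT Q V) :
      IsSubtree rx.1 t → Above rx sy →
      e₀ ∈ Zset rx → WSet Γ t E (p, rx, q) e₀ →
      WSet Γ t E (p, sy, q) (phUnit (p, rx, q), fun _ => 0)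
  | comp {p q p' q' : Q} {rx : NodeDesc V} {u v : EffT Q V} :
      WSet Γ t E (p, rx, q) ((phUnit (p', rx, q'), fun _ => (0 : ℤ)) + u) →
      WSet Γ t E (p', rx, q') v →
      WSet Γ t E (p, rx, q) (v + u)

end ValencePaper

namespace ValencePaper

variable {V Q : Type}

/-- The family `(W^R_τ)_{τ ∈ ρ(A)}` for a fixed set `R` of placeholders: the
smallest family such that
(1) for a leaf `s`, all effects of almost `R`-placeholder runs belong to
`W^R_{(p, nort(s), q)}`;
(2) if `r^x` is above `s^y` and `(p,s^y,q) ∈ R`, then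
`W^R_{(p,s^y,q)} ∩ Y_{r^x} ⊆ W^R_{(p,r^x,q)}`;
(3) if `r^x` is above `s^y` and `(p,r^x,q) ∈ R`, then the unit vector of
`(p,r^x,q)` belongs to `W^R_{(p,s^y,q)}`;
(4) if `(p',r^x,q') + u ∈ W^R_{(p,r^x,q)}` and `v ∈ W^R_{(p',r^x,q')}`, then
`v + u ∈ W^R_{(p,r^x,q)}`. -/
inductive WR (Γ : GGraph V) (t : DTree V) (E : Set (Q × GWord V × Q))
    (R : Set (PhT Q V)) : PhT Q V → EffT Q V → Prop
  | leaf {p q : Q} {s : DTree V} {e : EffT Q V} :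
      IsSubtree s t → childrenOf s = [] →
      AlmostPRunEff Γ t E R p (s, false) q e →
      WR Γ t E R (p, (s, false), q) e
  | up {p q : Q} {rx sy : NodeDesc V} {e : EffT Q V} :
      IsSubtree rx.1 t → Above rx sy → (p, sy, q) ∈ R →
      WR Γ t E R (p, sy, q) e → e ∈ Yset rx →
      WR Γ t E R (p, rx, q) e
  | down {p q : Q} {rx sy : NodeDesc V} :
      IsSubtree rx.1 t → Above rx sy → (p, rx, q) ∈ R →
      WR Γ t E R (p, sy, q) (phUnit (p, rx, q), fun _ => 0)
  | comp {p q p' q' : Q} {rx : NodeDesc V} {u v : EffT Q V} :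
      WR Γ t E R (p, rx, q) ((phUnit (p', rx, q'), fun _ => (0 : ℤ)) + u) →
      WR Γ t E R (p', rx, q') v →
      WR Γ t E R (p, rx, q) (v + u)

/-- The saturation sequence `R⁰ = ∅`, `R^{i+1} = {τ : W^{R^i}_τ ∩ Z_τ ≠ ∅}`. -/
def satR (Γ : GGraph V) (t : DTree V) (E : Set (Q × GWord V × Q)) :
    ℕ → Set (PhT Q V)
  | 0 => ∅
  | n + 1 => {τ | ∃ e, WR Γ t E (satR Γ t E n) τ e ∧ e ∈ Zset τ.2.1}

end ValencePaper

open ValencePaper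

namespace ValencePaper

variable {V Q : Type}

theorem IsSubtree.trans {a b c : DTree V} (hab : IsSubtree a b) (hbc : IsSubtree b c) :
    IsSubtree a c := by
  induction hbc with
  | refl => exact hab
  | child hc _ ih => exact .child hc ih

theorem StrictSubtree.isSubtree {s r : DTree V} (h : StrictSubtree s r) : IsSubtree s r := by
  obtain ⟨c, hc, hs⟩ := h
  cases r with
  | node U cs => exact .child hc hs

theorem Above.isSubtree {rx sy : NodeDesc V} (h : Above rx sy) : IsSubtree sy.1 rx.1 := by
  rcases h with h | ⟨h, -, -⟩
  · exact h.isSubtree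
  · exact h ▸ .refl _

theorem PSeq.mono {E : Set (Q × GWord V × Q)} {Ok Ok' : PhT Q V → Prop}
    (h : ∀ τ, Ok τ → Ok' τ) {p q : Q} {w : GWord V} {c : PhT Q V → ℕ}
    (hs : PSeq E Ok p w c q) : PSeq E Ok' p w c q := by
  induction hs with
  | base hr => exact .base hr
  | cons hr hok _ ih => exact .cons hr (h _ hok) ih

theorem AlmostPRunEff.mono {Γ : GGraph V} {t : DTree V} {E : Set (Q × GWord V × Q)}
    {R R' : Set (PhT Q V)} (hR : R ⊆ R') {p q : Q} {sx : NodeDesc V} {e : EffT Q V}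
    (h : AlmostPRunEff Γ t E R p sx q e) : AlmostPRunEff Γ t E R' p sx q e := by
  obtain ⟨w, c, hs, hrest⟩ := h
  exact ⟨w, c, hs.mono fun _ hτ => ⟨hR hτ.1, hτ.2⟩, hrest⟩

/-- The family `W^R` is supported on placeholders over subtrees of `t`. -/
theorem WR.isSubtree {Γ : GGraph V} {t : DTree V} {E : Set (Q × GWord V × Q)}
    {R : Set (PhT Q V)} {τ : PhT Q V} {e : EffT Q V} (h : WR Γ t E R τ e) :
    IsSubtree τ.2.1.1 t := by
  induction h with
  | leaf hs _ _ => exact hs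
  | up hr _ _ _ _ => exact hr
  | down hr hab _ => exact hab.isSubtree.trans hr
  | comp _ _ ih _ => exact ih

/-- If every placeholder of `R` has a witness in `W_τ ∩ Z_τ`, then `W^R ⊆ W`. -/
theorem WR.wSet {Γ : GGraph V} {t : DTree V} {E : Set (Q × GWord V × Q)}
    {R : Set (PhT Q V)}
    (hR : ∀ τ ∈ R, ∃ e, IsSubtree τ.2.1.1 t ∧ e ∈ Zset τ.2.1 ∧ WSet Γ t E τ e)
    {τ : PhT Q V} {e : EffT Q V} (h : WR Γ t E R τ e) : WSet Γ t E τ e := by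
  induction h with
  | leaf hs hleaf hrun =>
    choose! wit hsub hZ hW using hR
    exact .leaf wit hs hleaf (fun τ hτ => ⟨hsub τ hτ, hZ τ hτ⟩) hW hrun
  | up hr hab hmem _ hY ih =>
    obtain ⟨e₀, -, hZ, hW⟩ := hR _ hmem
    exact .up e₀ hr hab hZ hW ih hY
  | down hr hab hmem =>
    obtain ⟨e₀, -, hZ, hW⟩ := hR _ hmem
    exact .down e₀ hr hab hZ hW
  | comp _ _ ihu ihv => exact .comp ihu ihv

/-- If `R` contains every `τ` with `W^R_τ ∩ Z_τ ≠ ∅`, then `W ⊆ W^R`. -/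
theorem WSet.wR {Γ : GGraph V} {t : DTree V} {E : Set (Q × GWord V × Q)}
    {R : Set (PhT Q V)} (hR : ∀ τ e, WR Γ t E R τ e → e ∈ Zset τ.2.1 → τ ∈ R)
    {τ : PhT Q V} {e : EffT Q V} (h : WSet Γ t E τ e) : WR Γ t E R τ e := by
  induction h with
  | leaf wit hs hleaf hZ _ hrun ih =>
    exact .leaf hs hleaf (hrun.mono fun τ hτ => hR τ _ (ih τ hτ) (hZ τ hτ).2)
  | up e₀ hr hab hZ _ _ hY ih₀ ih => exact .up hr hab (hR _ _ ih₀ hZ) ih hY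
  | down e₀ hr hab hZ _ ih => exact .down hr hab (hR _ _ ih hZ)
  | comp _ _ ihu ihv => exact .comp ihu ihv

theorem exists_wSet_of_mem_satR {Γ : GGraph V} {t : DTree V} {E : Set (Q × GWord V × Q)}
    (n : ℕ) : ∀ τ ∈ satR Γ t E n,
      ∃ e, IsSubtree τ.2.1.1 t ∧ e ∈ Zset τ.2.1 ∧ WSet Γ t E τ e := by
  induction n with
  | zero => exact fun _ hτ => hτ.elim
  | succ n ih =>
    rintro τ ⟨e, hW, hZ⟩
    exact ⟨e, hW.isSubtree, hZ, hW.wSet ih⟩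

end ValencePaper

/-- Let `Γ ∈ SC±` have an unlooped vertex adjacent to all other
vertices, with decomposition tree `t`, let `A` be a valence system over `Γ`,
and consider the saturation sequence `R⁰ = ∅`,
`R^{i+1} = {τ ∈ ρ(A) : W^{R^i}_τ ∩ Z_τ ≠ ∅}`. If `n` satisfies
`R^{n+1} = R^n`, then for every placeholder `τ ∈ ρ(A)`, `W^{R^n}_τ = W_τ`. -/
theorem saturation_reaches_wset {V Q : Type} [Finite V] [Finite Q]
    (Γ : GGraph V) (hSC : InSCpm Γ)
    (hUniv : ∃ v, ¬ Γ.adj v v ∧ ∀ w, w ≠ v → Γ.adj v w)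
    (t : DTree V) (ht : IsDecompOf Γ Set.univ t)
    (E : Set (Q × GWord V × Q)) (hEfin : E.Finite)
    (n : ℕ) (hn : satR Γ t E (n + 1) = satR Γ t E n) :
    ∀ τ : PhT Q V, IsSubtree τ.2.1.1 t →
      ∀ e : EffT Q V, WR Γ t E (satR Γ t E n) τ e ↔ WSet Γ t E τ e := by
  intro τ _ e
  refine ⟨fun h => h.wSet (exists_wSet_of_mem_satR n), fun h => h.wR fun τ e hW hZ => ?_⟩
  rw [← hn]
  exact ⟨e, hW, hZ⟩
end
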